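/- arXiv:1010.5699 — 2 statements merged into one kernel-verified Lean document; each statement's English description precedes it below -/
import Mathlib

section
/- Let U be a finite-dimensional real vector space, E a finite nonempty set, and for each e∈E let A_e be a nonzero linear subspace of U. Let H be a linear hyperplane of U (a subspace of codimension 1) that is generic relative to the family {A_e}: for every e₁,e₂∈E and every F⊆E, writing S = Σ_{e∈F}(A_e∩H), if ((A_{e₁}∩H) + S) ∩ ((A_{e₂}∩H) + S) ≠ S, then (A_{e₁} + S) ∩ (A_{e₂} + S) is not contained in H. Then dim Σ_{e∈E}(A_e∩H) = min over all partitions {E_1,…,E_k} of E into nonempty parts of Σ_{i=1}^k (dim Σ_{e∈E_i} A_e − 1). (Lovász's Dilworth truncation theorem, with the corrected genericity hypothesis.) -/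
/- STATEMENT 10 (Lovász, Dilworth truncation): if `H` is a hyperplane generic relative to the
family `{A_e}` (with the corrected genericity condition), then the dimension of
`Σ_e (A_e ∩ H)` equals the minimum over partitions `{E_1,…,E_k}` of `E` of
`Σ_i (dim Σ_{e∈E_i} A_e − 1)`. -/

set_option synthInstance.maxHeartbeats 1000000
set_option maxHeartbeats 1000000

/-- `P` is a partition of `F` into nonempty parts. -/
def IsPartitionOf {E : Type} [DecidableEq E] (F : Finset E) (P : Finset (Finset E)) : Prop :=
  (∀ p ∈ P, p.Nonempty) ∧ (P : Set (Finset E)).PairwiseDisjoint id ∧ P.biUnion id = F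

open Module in
theorem hyp_decomp {U : Type} [AddCommGroup U] [Module ℝ U] [FiniteDimensional ℝ U]
    (H : Submodule ℝ U) (hH : finrank ℝ ↥H + 1 = finrank ℝ U)
    (X : Submodule ℝ U) (hX : ¬ X ≤ H) : X ⊔ H = ⊤ := by
  have h1 : H < X ⊔ H := lt_of_le_of_ne le_sup_right (fun h => hX (h ▸ le_sup_left))
  have h2 := Submodule.finrank_lt_finrank_of_lt h1
  have h3 := Submodule.finrank_le (X ⊔ H)
  exact Submodule.eq_top_of_finrank_eq (by omega)

open Module in
theorem hyp_finrank {U : Type} [AddCommGroup U] [Module ℝ U] [FiniteDimensional ℝ U]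
    (H : Submodule ℝ U) (hH : finrank ℝ ↥H + 1 = finrank ℝ U)
    (X : Submodule ℝ U) (hX : ¬ X ≤ H) :
    finrank ℝ ↥X = finrank ℝ ↥(X ⊓ H) + 1 := by
  have h1 := Submodule.finrank_sup_add_finrank_inf_eq X H
  rw [hyp_decomp H hH X hX, finrank_top] at h1
  omega

open Module in
theorem hyp_vec {U : Type} [AddCommGroup U] [Module ℝ U] [FiniteDimensional ℝ U]
    (H : Submodule ℝ U) (hH : finrank ℝ ↥H + 1 = finrank ℝ U)
    (v : U) (hv : v ∉ H) (y : U) : ∃ c : ℝ, y - c • v ∈ H := by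
  have h1 := hyp_decomp H hH (Submodule.span ℝ {v}) (by
    rw [Submodule.span_singleton_le_iff_mem]; exact hv)
  have h2 : y ∈ Submodule.span ℝ {v} ⊔ H := by rw [h1]; trivial
  obtain ⟨a, ha, b, hb, hab⟩ := Submodule.mem_sup.1 h2
  obtain ⟨c, rfl⟩ := Submodule.mem_span_singleton.1 ha
  exact ⟨c, by rw [← hab]; simpa using hb⟩

theorem chain_step {U E : Type} [AddCommGroup U] [Module ℝ U] [DecidableEq E]
    (C : E → Submodule ℝ U) (x : U) (S : Finset E) (hS : x ∉ ⨆ e ∈ S, C e) (p : Finset E)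
    (hp : x ∈ ⨆ e ∈ S ∪ p, C e) :
    ∃ (X : Finset E) (f : E), f ∈ p ∧ X ⊆ S ∪ p ∧ x ∉ (⨆ e ∈ X, C e) ∧
      x ∈ ⨆ e ∈ insert f X, C e := by
  induction p using Finset.induction_on with
  | empty => simp at hp; exact absurd hp (by simpa using hS)
  | insert a p ha ih =>
    by_cases h : x ∈ ⨆ e ∈ S ∪ p, C e
    · obtain ⟨X, f, hf, hX, h1, h2⟩ := ih h
      exact ⟨X, f, Finset.mem_insert_of_mem hf,
        hX.trans (Finset.union_subset_union_right (Finset.subset_insert _ _)), h1, h2⟩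
    · refine ⟨S ∪ p, a, Finset.mem_insert_self _ _,
        Finset.union_subset_union_right (Finset.subset_insert _ _), h, ?_⟩
      rwa [Finset.union_insert] at hp

open Module in
theorem finrank_biUnion_le {U E : Type} [AddCommGroup U] [Module ℝ U] [FiniteDimensional ℝ U]
    [DecidableEq E] (C : E → Submodule ℝ U) (g : Finset E → ℕ) (P : Finset (Finset E))
    (h : ∀ p ∈ P, finrank ℝ ↥(⨆ e ∈ p, C e) ≤ g p) :
    finrank ℝ ↥(⨆ e ∈ P.biUnion id, C e) ≤ ∑ p ∈ P, g p := by
  induction P using Finset.induction_on with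
  | empty =>
    have h0 : (⨆ e ∈ (∅ : Finset (Finset E)).biUnion id, C e) = ⊥ := by simp
    rw [h0, finrank_bot]; simp
  | insert a P ha ih =>
    rw [Finset.biUnion_insert, Finset.sum_insert ha, Finset.iSup_union]
    have h1 := ih (fun p hp => h p (Finset.mem_insert_of_mem hp))
    have h2 := h a (Finset.mem_insert_self _ _)
    have h3 := Submodule.finrank_add_le_finrank_add_finrank (⨆ e ∈ id a, C e)
      (⨆ e ∈ P.biUnion id, C e)
    exact h3.trans (Nat.add_le_add h2 h1)

theorem mono_fs {U E : Type} [AddCommGroup U] [Module ℝ U]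
    (C : E → Submodule ℝ U) {X Y : Finset E} (h : X ⊆ Y) :
    (⨆ e ∈ X, C e) ≤ ⨆ e ∈ Y, C e := biSup_mono (fun _ hx => h hx)

open Module in
theorem main_claim
    (U : Type) [AddCommGroup U] [Module ℝ U] [FiniteDimensional ℝ U]
    (E : Type) [DecidableEq E]
    (A : E → Submodule ℝ U)
    (H : Submodule ℝ U) (hH : Module.finrank ℝ ↥H + 1 = Module.finrank ℝ U)
    (hgen : ∀ e₁ e₂ : E, ∀ F : Finset E,
      ((A e₁ ⊓ H) ⊔ (⨆ e ∈ F, A e ⊓ H)) ⊓ ((A e₂ ⊓ H) ⊔ (⨆ e ∈ F, A e ⊓ H))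
          ≠ (⨆ e ∈ F, A e ⊓ H) →
      ¬ ((A e₁ ⊔ (⨆ e ∈ F, A e ⊓ H)) ⊓ (A e₂ ⊔ (⨆ e ∈ F, A e ⊓ H)) ≤ H))
    (F : Finset E) :
    ∃ P : Finset (Finset E), IsPartitionOf F P ∧
      (∀ p ∈ P, (⨆ e ∈ p, A e) ⊓ H ≤ ⨆ e ∈ p, A e ⊓ H) ∧
      ∑ p ∈ P, finrank ℝ ↥((⨆ e ∈ p, A e) ⊓ H) ≤ finrank ℝ ↥(⨆ e ∈ F, A e ⊓ H) := by
  induction F using Finset.induction_on with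
  | empty => exact ⟨∅, by simp [IsPartitionOf], by simp, by simp⟩
  | insert e F he ih =>
    obtain ⟨P, ⟨hne, hdis, hun⟩, hP, hsum⟩ := ih
    have hex : ∃ I : Finset (Finset E), I ⊆ P ∧
        (A e ⊓ H) ⊓ (⨆ f ∈ F, A f ⊓ H) ≤ ⨆ f ∈ I.biUnion id, A f ⊓ H :=
      ⟨P, subset_rfl, by rw [hun]; exact inf_le_right⟩
    obtain ⟨I, hI⟩ := exists_minimal_of_wellFoundedLT
      (fun I : Finset (Finset E) => I ⊆ P ∧
        (A e ⊓ H) ⊓ (⨆ f ∈ F, A f ⊓ H) ≤ ⨆ f ∈ I.biUnion id, A f ⊓ H) hex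
    obtain ⟨⟨hIP, hIle⟩, hmin⟩ := hI
    set J := I.biUnion id with hJ
    have hJF : J ⊆ F := by rw [← hun]; exact Finset.biUnion_subset_biUnion_of_subset_left _ hIP
    set N := insert e J with hN
    have hpN : ∀ p ∈ I, p ⊆ N := fun p hp =>
      (Finset.subset_biUnion_of_mem id hp).trans (Finset.subset_insert _ _)
    have hTH : ∀ X : Finset E, (⨆ f ∈ X, A f ⊓ H) ≤ H := fun X =>
      iSup₂_le (fun _ _ => inf_le_right)
    have hAeN : A e ⊓ H ≤ ⨆ f ∈ N, A f ⊓ H :=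
      le_biSup (fun f => A f ⊓ H) (Finset.mem_insert_self e J)
    -- key
    have key : ∀ p ∈ I, (⨆ f ∈ p, A f) ≤ A e ⊔ ⨆ f ∈ N, A f ⊓ H := by
      intro p hp
      have hnot : ¬ ((A e ⊓ H) ⊓ (⨆ f ∈ F, A f ⊓ H) ≤
          ⨆ f ∈ (I.erase p).biUnion id, A f ⊓ H) := by
        intro h
        have := hmin ⟨(Finset.erase_subset _ _).trans hIP, h⟩ (Finset.erase_subset _ _)
        exact Finset.notMem_erase p I (this hp)
      obtain ⟨x, hx, hxn⟩ := SetLike.not_le_iff_exists.1 hnot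
      have hun2 : (I.erase p).biUnion id ∪ p = J := by
        rw [hJ, ← Finset.insert_erase hp, Finset.biUnion_insert, Finset.union_comm]
        simp
      obtain ⟨X, f, hf, hX, hx1, hx2⟩ := chain_step (fun f => A f ⊓ H) x _ hxn p
        (by rw [hun2]; exact hIle hx)
      rw [hun2] at hX
      have hXN : (⨆ f ∈ X, A f ⊓ H) ≤ ⨆ f ∈ N, A f ⊓ H :=
        mono_fs (fun f => A f ⊓ H) (hX.trans (Finset.subset_insert _ _))
      have hg := hgen e f X (by
        intro heq
        apply hx1
        rw [← heq]
        refine ⟨Submodule.mem_sup_left hx.1, ?_⟩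
        rwa [Finset.iSup_insert] at hx2)
      obtain ⟨v, hv, hvH⟩ := SetLike.not_le_iff_exists.1 hg
      obtain ⟨hv1, hv2⟩ := hv
      obtain ⟨a, ha, t, ht, hat⟩ := Submodule.mem_sup.1 hv2
      have haH : a ∉ H := fun h => hvH (hat ▸ H.add_mem h (hTH _ ht))
      intro y hy
      obtain ⟨c, hc⟩ := hyp_vec H hH a haH y
      have hap : a ∈ ⨆ f ∈ p, A f := (le_biSup A hf) ha
      have h1 : y - c • a ∈ ⨆ f ∈ N, A f ⊓ H :=
        (mono_fs (fun f => A f ⊓ H) (hpN p hp))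
          (hP p (hIP hp) ⟨Submodule.sub_mem _ hy (Submodule.smul_mem _ _ hap), hc⟩)
      have h2 : v ∈ A e ⊔ ⨆ f ∈ N, A f ⊓ H := (sup_le_sup_left hXN _) hv1
      have h3 : y = (y - c • a) + (c • v - c • t) := by
        rw [← hat]; module
      rw [h3]
      exact Submodule.add_mem _ (Submodule.mem_sup_right h1)
        (Submodule.sub_mem _ (Submodule.smul_mem _ _ h2)
          (Submodule.mem_sup_right (Submodule.smul_mem _ _ (hXN ht))))
    have hBN : (⨆ f ∈ N, A f) ⊓ H ≤ ⨆ f ∈ N, A f ⊓ H := by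
      have hle : (⨆ f ∈ N, A f) ≤ A e ⊔ ⨆ f ∈ N, A f ⊓ H := by
        rw [hN, Finset.iSup_insert, hJ, Finset.iSup_biUnion]
        exact sup_le le_sup_left (iSup₂_le key)
      rintro y ⟨hy, hyH⟩
      obtain ⟨a, ha, t, ht, rfl⟩ := Submodule.mem_sup.1 (hle hy)
      have haH : a ∈ H := by
        have := H.sub_mem hyH (hTH _ ht)
        simpa using this
      exact Submodule.add_mem _ (hAeN ⟨ha, haH⟩) ht
    have heJ : e ∉ J := fun h => he (hJF h)
    have hNP : N ∉ P \ I := by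
      intro h
      apply he
      rw [← hun]
      exact Finset.mem_biUnion.2 ⟨N, (Finset.mem_sdiff.1 h).1, Finset.mem_insert_self _ _⟩
    have hdJ : ∀ q ∈ P \ I, Disjoint N q := by
      intro q hq
      obtain ⟨hqP, hqI⟩ := Finset.mem_sdiff.1 hq
      rw [hN, Finset.disjoint_insert_left]
      constructor
      · intro h; apply he; rw [← hun]
        exact Finset.mem_biUnion.2 ⟨q, hqP, h⟩
      · rw [hJ, Finset.disjoint_biUnion_left]
        intro r hr
        exact hdis (hIP hr) hqP (fun h => hqI (h ▸ hr))
    refine ⟨insert N (P \ I), ⟨?_, ?_, ?_⟩, ?_, ?_⟩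
    · intro p hp
      rcases Finset.mem_insert.1 hp with rfl | hp
      · exact Finset.insert_nonempty _ _
      · exact hne p (Finset.mem_sdiff.1 hp).1
    · rw [Finset.coe_insert]
      apply Set.PairwiseDisjoint.insert
      · exact hdis.subset (by exact_mod_cast Finset.sdiff_subset)
      · intro q hq _
        exact hdJ q (by exact_mod_cast hq)
    · rw [Finset.biUnion_insert, ← hun, ← Finset.union_sdiff_of_subset hIP,
        Finset.union_biUnion]
      simp only [id, hN, Finset.insert_union, Finset.union_sdiff_of_subset hIP]
      rfl
    · intro p hp
      rcases Finset.mem_insert.1 hp with rfl | hp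
      · exact hBN
      · exact hP p (Finset.mem_sdiff.1 hp).1
    · rw [Finset.sum_insert hNP]
      have h1 := Finset.sum_sdiff (f := fun p => finrank ℝ ↥((⨆ e ∈ p, A e) ⊓ H)) hIP
      have h2 := finrank_biUnion_le (fun f => A f ⊓ H)
        (fun p => finrank ℝ ↥((⨆ e ∈ p, A e) ⊓ H)) I
        (fun p _ => Submodule.finrank_mono
          (le_inf (iSup₂_mono (fun _ _ => inf_le_left)) (hTH p)))
      have h3 := Submodule.finrank_mono hBN
      have h4 := Submodule.finrank_sup_add_finrank_inf_eq (A e ⊓ H) (⨆ f ∈ F, A f ⊓ H)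
      have h5 := Submodule.finrank_sup_add_finrank_inf_eq (A e ⊓ H) (⨆ f ∈ J, A f ⊓ H)
      have h6 : (A e ⊓ H) ⊓ (⨆ f ∈ F, A f ⊓ H) = (A e ⊓ H) ⊓ (⨆ f ∈ J, A f ⊓ H) :=
        le_antisymm (le_inf inf_le_left hIle)
          (inf_le_inf_left _ (mono_fs (fun f => A f ⊓ H) hJF))
      rw [h6] at h4
      have h7 : (⨆ f ∈ N, A f ⊓ H) = (A e ⊓ H) ⊔ (⨆ f ∈ J, A f ⊓ H) := by
        rw [hN, Finset.iSup_insert]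
      rw [h7] at h3
      have h8 : (⨆ f ∈ insert e F, A f ⊓ H) = (A e ⊓ H) ⊔ (⨆ f ∈ F, A f ⊓ H) := by
        rw [Finset.iSup_insert]
      rw [h8]
      rw [← hJ] at h2
      omega

theorem statement_10
    (U : Type) [AddCommGroup U] [Module ℝ U] [FiniteDimensional ℝ U]
    (E : Type) [Fintype E] [DecidableEq E] [Nonempty E]
    (A : E → Submodule ℝ U) (hA : ∀ e : E, A e ≠ ⊥)
    (H : Submodule ℝ U) (hH : Module.finrank ℝ ↥H + 1 = Module.finrank ℝ U)
    (hgen : ∀ e₁ e₂ : E, ∀ F : Finset E,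
      ((A e₁ ⊓ H) ⊔ (⨆ e ∈ F, A e ⊓ H)) ⊓ ((A e₂ ⊓ H) ⊔ (⨆ e ∈ F, A e ⊓ H))
          ≠ (⨆ e ∈ F, A e ⊓ H) →
      ¬ ((A e₁ ⊔ (⨆ e ∈ F, A e ⊓ H)) ⊓ (A e₂ ⊔ (⨆ e ∈ F, A e ⊓ H)) ≤ H)) :
    IsLeast
      {s : ℤ | ∃ P : Finset (Finset E), IsPartitionOf Finset.univ P ∧
        s = ∑ p ∈ P, ((Module.finrank ℝ ↥(⨆ e ∈ p, A e) : ℤ) - 1)}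
      (Module.finrank ℝ ↥(⨆ e : E, A e ⊓ H) : ℤ) := by
  have hAH : ∀ e, ¬ A e ≤ H := by
    intro e hle
    have := hgen e e ∅
    simp only [Finset.notMem_empty, iSup_false, iSup_bot, sup_bot_eq, inf_idem] at this
    refine this ?_ hle
    rw [inf_eq_left.2 hle]; exact hA e
  have hfr : ∀ p : Finset E, p.Nonempty →
      (Module.finrank ℝ ↥(⨆ e ∈ p, A e) : ℤ) - 1
        = (Module.finrank ℝ ↥((⨆ e ∈ p, A e) ⊓ H) : ℕ) := by
    rintro p ⟨e, he⟩
    have := hyp_finrank H hH (⨆ e ∈ p, A e) (fun h => hAH e ((le_biSup A he).trans h))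
    omega
  have huniv : (⨆ e ∈ (Finset.univ : Finset E), A e ⊓ H) = ⨆ e : E, A e ⊓ H := by simp
  have hup : ∀ P : Finset (Finset E), IsPartitionOf Finset.univ P →
      Module.finrank ℝ ↥(⨆ e : E, A e ⊓ H) ≤
        ∑ p ∈ P, Module.finrank ℝ ↥((⨆ e ∈ p, A e) ⊓ H) := by
    intro P hP
    have := finrank_biUnion_le (fun f => A f ⊓ H)
        (fun p => Module.finrank ℝ ↥((⨆ e ∈ p, A e) ⊓ H)) P
        (fun p _ => Submodule.finrank_mono
          (le_inf (iSup₂_mono (fun _ _ => inf_le_left)) (iSup₂_le (fun _ _ => inf_le_right))))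
    rw [hP.2.2, huniv] at this
    exact this
  have hsum : ∀ P : Finset (Finset E), IsPartitionOf Finset.univ P →
      ∑ p ∈ P, ((Module.finrank ℝ ↥(⨆ e ∈ p, A e) : ℤ) - 1)
       = ((∑ p ∈ P, Module.finrank ℝ ↥((⨆ e ∈ p, A e) ⊓ H) : ℕ) : ℤ) := by
    intro P hP
    rw [Nat.cast_sum]
    exact Finset.sum_congr rfl (fun p hp => hfr p (hP.1 p hp))
  constructor
  · obtain ⟨P, hP, -, h⟩ := main_claim U E A H hH hgen Finset.univ
    refine ⟨P, hP, ?_⟩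
    rw [hsum P hP]
    have := hup P hP
    rw [huniv] at h
    exact_mod_cast le_antisymm this h
  · rintro s ⟨P, hP, rfl⟩
    rw [hsum P hP]
    exact_mod_cast hup P hP
end

section
/- Let U be a 4-dimensional real vector space, let A_1, A_2, A_3 be pairwise distinct 3-dimensional subspaces of U, and let L be a 2-dimensional subspace with A_1∩A_2 = A_2∩A_3 = A_3∩A_1 = L. Let H be a 3-dimensional subspace with L ⊆ H and H ∉ {A_1, A_2, A_3}. Then dim((A_1∩H) + (A_2∩H) + (A_3∩H)) = 2, whereas the minimum over all partitions {I_1,…,I_k} of {1,2,3} into nonempty parts of Σ_j (dim Σ_{i∈I_j} A_i − 1) equals 3; in particular the Dilworth truncation rank formula fails for this hyperplane H. -/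
/- STATEMENT 11: the counterexample showing that Lovász's weaker genericity condition does
not suffice for Dilworth truncation: for three 3-dimensional subspaces of a 4-dimensional
space meeting pairwise in a common line `L ⊆ H`, the truncated span has dimension 2 while
the partition minimum is 3. -/

set_option synthInstance.maxHeartbeats 1000000
set_option maxHeartbeats 1000000

theorem statement_11
    (U : Type) [AddCommGroup U] [Module ℝ U] [FiniteDimensional ℝ U]
    (hU : Module.finrank ℝ U = 4)
    (A : Fin 3 → Submodule ℝ U)
    (hAdim : ∀ i, Module.finrank ℝ ↥(A i) = 3)
    (hAdist : ∀ i j, i ≠ j → A i ≠ A j)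
    (L : Submodule ℝ U) (hL : Module.finrank ℝ ↥L = 2)
    (hcap : ∀ i j, i ≠ j → A i ⊓ A j = L)
    (H : Submodule ℝ U) (hHdim : Module.finrank ℝ ↥H = 3)
    (hLH : L ≤ H) (hHA : ∀ i, H ≠ A i) :
    Module.finrank ℝ ↥((A 0 ⊓ H) ⊔ (A 1 ⊓ H) ⊔ (A 2 ⊓ H)) = 2 ∧
    IsLeast
      {s : ℤ | ∃ P : Finset (Finset (Fin 3)), IsPartitionOf Finset.univ P ∧
        s = ∑ p ∈ P, ((Module.finrank ℝ ↥(⨆ i ∈ p, A i) : ℤ) - 1)}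
      3 := by
  have hAH : ∀ i, A i ⊓ H = L := by
    intro i
    have hj : ∃ j, i ≠ j := by
      fin_cases i
      · exact ⟨1, by decide⟩
      · exact ⟨0, by decide⟩
      · exact ⟨0, by decide⟩
    obtain ⟨j, hj⟩ := hj
    have hLA : L ≤ A i := by rw [← hcap i j hj]; exact inf_le_left
    symm
    apply Submodule.eq_of_le_of_finrank_le (le_inf hLA hLH)
    by_contra hlt
    have h1 : A i ⊓ H = H :=
      Submodule.eq_of_le_of_finrank_le inf_le_right (by omega)
    have h2 : H ≤ A i := inf_eq_right.mp h1
    exact hHA i (Submodule.eq_of_le_of_finrank_le h2 (by rw [hAdim i, hHdim]))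
  have htop : Module.finrank ℝ ↥(⨆ i ∈ (Finset.univ : Finset (Fin 3)), A i) = 4 := by
    have h1 := Submodule.finrank_sup_add_finrank_inf_eq (A 0) (A 1)
    rw [hcap 0 1 (by decide), hL, hAdim, hAdim] at h1
    have h2 : A 0 ⊔ A 1 ≤ ⨆ i ∈ (Finset.univ : Finset (Fin 3)), A i :=
      sup_le (le_biSup A (Finset.mem_univ 0)) (le_biSup A (Finset.mem_univ 1))
    have h3 := Submodule.finrank_mono h2
    have h4 := Submodule.finrank_le (⨆ i ∈ (Finset.univ : Finset (Fin 3)), A i)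
    omega
  refine ⟨by rw [hAH, hAH, hAH, sup_idem, sup_idem, hL], ?_, ?_⟩
  · refine ⟨{Finset.univ}, ⟨?_, ?_, ?_⟩, ?_⟩
    · intro p hp
      rw [Finset.mem_singleton.mp hp]
      exact Finset.univ_nonempty
    · simp
    · simp
    · rw [Finset.sum_singleton, htop]; norm_num
  · rintro s ⟨P, ⟨hne, -, hun⟩, rfl⟩
    have hterm : ∀ p ∈ P, (2 : ℤ) ≤ (Module.finrank ℝ ↥(⨆ i ∈ p, A i) : ℤ) - 1 := by
      intro p hp
      obtain ⟨i, hi⟩ := hne p hp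
      have hle : A i ≤ ⨆ i ∈ p, A i := le_biSup A hi
      have h := Submodule.finrank_mono hle
      rw [hAdim] at h
      omega
    have hsum := Finset.card_nsmul_le_sum P _ _ hterm
    rw [nsmul_eq_mul] at hsum
    rcases Nat.lt_or_ge P.card 2 with hc | hc
    · have hc' : P.card = 0 ∨ P.card = 1 := by omega
      rcases hc' with h0 | h1
      · rw [Finset.card_eq_zero] at h0
        subst h0
        have : (0 : Fin 3) ∈ (∅ : Finset (Finset (Fin 3))).biUnion id := by
          rw [hun]; exact Finset.mem_univ _
        simp at this
      · obtain ⟨p, rfl⟩ := Finset.card_eq_one.mp h1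
        rw [Finset.singleton_biUnion, id] at hun
        subst hun
        rw [Finset.sum_singleton, htop]; norm_num
    · have : (2 : ℤ) ≤ P.card := by exact_mod_cast hc
      linarith
end
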